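/- arXiv:1602.04017 — 2 statements merged into one kernel-verified Lean document; each statement's English description precedes it below -/
import Mathlib

section
/- Let γ ≥ 0 and let f ∈ S(ℝ₊). Set a_n = ∫₀^∞ f(t) 𝓛_n^γ(t) t^γ dt for n ∈ ℕ₀. Then the sequence (a_n) is rapidly decreasing: for every j ∈ ℕ there exists C > 0 such that |a_n| ≤ C (n+1)^{−j} for all n ∈ ℕ₀. -/
open MeasureTheory Filter Finset

noncomputable section

/-- The space `S(ℝ₊)`: smooth on `(0,∞)`, all derivatives extend continuously to `[0,∞)`,
and `sup_{t>0} |t^k D^p f(t)| < ∞` for all `k, p`. -/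
def IsSPlus1 (f : ℝ → ℂ) : Prop :=
  ContDiffOn ℝ (⊤ : ℕ∞) f (Set.Ioi 0) ∧
  (∀ p : ℕ, ∃ g : ℝ → ℂ, ContinuousOn g (Set.Ici 0) ∧ ∀ t > (0:ℝ), g t = deriv^[p] f t) ∧
  (∀ k p : ℕ, ∃ C : ℝ, ∀ t > (0:ℝ), t ^ k * ‖deriv^[p] f t‖ ≤ C)

/-- Laguerre polynomial of order `γ`:
`L_j^γ(t) = ∑_{k=0}^j (Γ(j+γ+1)/(Γ(k+γ+1)(j−k)! k!)) (−t)^k`. -/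
def lagP (γ : ℝ) (j : ℕ) (t : ℝ) : ℝ :=
  ∑ k ∈ Finset.range (j+1),
    Real.Gamma (j + γ + 1) / (Real.Gamma (k + γ + 1) * (j-k).factorial * (k.factorial)) * (-t)^k

/-- Laguerre function of order `γ`: `𝓛_j^γ(t) = (j!/Γ(j+γ+1))^{1/2} L_j^γ(t) e^{−t/2}`. -/
def lagFun (γ : ℝ) (j : ℕ) (t : ℝ) : ℝ :=
  Real.sqrt (j.factorial / Real.Gamma (j + γ + 1)) * lagP γ j t * Real.exp (-t/2)

open scoped Topology Nat

/-- The coefficient of `(-t)^k` in `L_j^γ(t)`. -/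
def lagCoeff (γ : ℝ) (j k : ℕ) : ℝ :=
  Real.Gamma (j + γ + 1) / (Real.Gamma (k + γ + 1) * (j - k).factorial * k.factorial)

lemma lagP_eq_sum (γ : ℝ) (j : ℕ) (t : ℝ) :
    lagP γ j t = ∑ k ∈ Finset.range (j + 1), lagCoeff γ j k * (-t) ^ k := rfl

lemma gamma_natCast_add_pos {γ : ℝ} (hγ : 0 ≤ γ) (k : ℕ) : 0 < Real.Gamma (k + γ + 1) :=
  Real.Gamma_pos_of_pos (by positivity)

lemma gamma_natCast_add_succ {γ : ℝ} (hγ : 0 ≤ γ) (k : ℕ) :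
    Real.Gamma (k + γ + 1 + 1) = (k + γ + 1) * Real.Gamma (k + γ + 1) :=
  Real.Gamma_add_one (by positivity)

lemma lagP_zero {γ : ℝ} (hγ : 0 ≤ γ) (t : ℝ) : lagP γ 0 t = 1 := by
  have := (gamma_natCast_add_pos hγ 0).ne'
  simp only [lagP_eq_sum, lagCoeff]
  simpa using div_self this

lemma lagCoeff_zero_right {γ : ℝ} (hγ : 0 ≤ γ) (n : ℕ) :
    (n + 1) * lagCoeff γ (n + 1) 0 = (γ + 1) * lagCoeff (γ + 1) n 0 := by
  have h1 := (gamma_natCast_add_pos hγ 0).ne'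
  have h2 := gamma_natCast_add_succ hγ 0
  simp only [lagCoeff, Nat.sub_zero, Nat.factorial_succ]
  push_cast at *
  rw [show (n : ℝ) + 1 + γ + 1 = n + (γ + 1) + 1 by ring,
    show (0 : ℝ) + (γ + 1) + 1 = 0 + γ + 1 + 1 by ring, h2]
  simp only [zero_add] at *
  field_simp

lemma lagCoeff_self {γ : ℝ} (hγ : 0 ≤ γ) (n : ℕ) :
    (n + 1) * lagCoeff γ (n + 1) (n + 1) = lagCoeff (γ + 1) n n := by
  have h1 := (gamma_natCast_add_pos hγ (n + 1)).ne'
  simp only [lagCoeff, Nat.sub_self, Nat.factorial_succ]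
  push_cast at *
  rw [show (n : ℝ) + (γ + 1) + 1 = n + 1 + γ + 1 by ring]
  field_simp

lemma lagCoeff_succ_succ {γ : ℝ} (hγ : 0 ≤ γ) {n k : ℕ} (hk : k < n) :
    (n + 1) * lagCoeff γ (n + 1) (k + 1) =
      (k + 1 + (γ + 1)) * lagCoeff (γ + 1) n (k + 1) + lagCoeff (γ + 1) n k := by
  obtain ⟨m, rfl⟩ : ∃ m, n = k + m + 1 := ⟨n - k - 1, by omega⟩
  have h1 := (gamma_natCast_add_pos hγ (k + 1)).ne'
  have h2 := gamma_natCast_add_succ hγ (k + 1)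
  have h3 : (k : ℝ) + 1 + γ + 1 ≠ 0 := by positivity
  simp only [lagCoeff, Nat.factorial_succ, show k + m + 1 + 1 - (k + 1) = m + 1 by omega,
    show k + m + 1 - (k + 1) = m by omega, show k + m + 1 - k = m + 1 by omega]
  push_cast at *
  rw [show (k : ℝ) + m + 1 + 1 + γ + 1 = k + m + 1 + (γ + 1) + 1 by ring,
    show (k : ℝ) + 1 + (γ + 1) + 1 = k + 1 + γ + 1 + 1 by ring,
    show (k : ℝ) + (γ + 1) + 1 = k + 1 + γ + 1 by ring, h2]
  field_simp
  ring

lemma succ_mul_lagCoeff_succ (γ : ℝ) (n k : ℕ) :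
    (k + 1) * lagCoeff γ (n + 1) (k + 1) = lagCoeff (γ + 1) n k := by
  simp only [lagCoeff, Nat.factorial_succ, Nat.add_sub_add_right]
  push_cast
  rw [show (n : ℝ) + 1 + γ + 1 = n + (γ + 1) + 1 by ring,
    show (k : ℝ) + 1 + γ + 1 = k + (γ + 1) + 1 by ring]
  field_simp

/-- The derivative of a Laguerre polynomial, term by term. -/
def lagPDeriv (γ : ℝ) (j : ℕ) (t : ℝ) : ℝ :=
  ∑ k ∈ Finset.range (j + 1), lagCoeff γ j k * (-(k * (-t) ^ (k - 1)))

lemma hasDerivAt_lagP (γ : ℝ) (j : ℕ) (t : ℝ) : HasDerivAt (lagP γ j) (lagPDeriv γ j t) t := by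
  unfold lagPDeriv
  rw [show lagP γ j = fun t => _ from funext (lagP_eq_sum γ j)]
  refine HasDerivAt.fun_sum fun k _ => HasDerivAt.const_mul _ ?_
  simpa using (hasDerivAt_neg t).fun_pow k

lemma continuous_lagP (γ : ℝ) (j : ℕ) : Continuous (lagP γ j) :=
  continuous_iff_continuousAt.2 fun t => (hasDerivAt_lagP γ j t).continuousAt

lemma lagPDeriv_succ (γ : ℝ) (n : ℕ) (t : ℝ) :
    lagPDeriv γ (n + 1) t = -lagP (γ + 1) n t := by
  rw [lagPDeriv, Finset.sum_range_succ', lagP_eq_sum, ← Finset.sum_neg_distrib]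
  simp only [Nat.cast_zero, zero_mul, neg_zero, mul_zero, add_zero]
  refine Finset.sum_congr rfl fun k _ => ?_
  rw [← succ_mul_lagCoeff_succ]
  push_cast
  ring

/-- The polynomial form of the raising relation
`(t^{γ+1} e^{-t} L_n^{γ+1})' = (n+1) t^γ e^{-t} L_{n+1}^γ`. -/
lemma lagP_raising {γ : ℝ} (hγ : 0 ≤ γ) (n : ℕ) (t : ℝ) :
    t * lagPDeriv (γ + 1) n t + (γ + 1 - t) * lagP (γ + 1) n t = (n + 1) * lagP γ (n + 1) t := by
  have h1 : t * lagPDeriv (γ + 1) n t + (γ + 1) * lagP (γ + 1) n t =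
      ∑ k ∈ Finset.range (n + 1), (k + (γ + 1)) * lagCoeff (γ + 1) n k * (-t) ^ k := by
    rw [lagPDeriv, lagP_eq_sum, Finset.mul_sum, Finset.mul_sum, ← Finset.sum_add_distrib]
    refine Finset.sum_congr rfl fun k _ => ?_
    rcases k with _ | k
    · simp
    · simp only [Nat.add_sub_cancel]
      ring
  have h2 : -t * lagP (γ + 1) n t =
      ∑ k ∈ Finset.range (n + 1), lagCoeff (γ + 1) n k * (-t) ^ (k + 1) := by
    rw [lagP_eq_sum, Finset.mul_sum]
    exact Finset.sum_congr rfl fun k _ => by ring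
  have h3 : (n + 1) * lagP γ (n + 1) t =
      ∑ k ∈ Finset.range (n + 2), (n + 1) * lagCoeff γ (n + 1) k * (-t) ^ k := by
    rw [lagP_eq_sum, Finset.mul_sum]
    exact Finset.sum_congr rfl fun k _ => by ring
  have h4 : ∑ k ∈ Finset.range n, (n + 1) * lagCoeff γ (n + 1) (k + 1) * (-t) ^ (k + 1) =
      ∑ k ∈ Finset.range n,
        ((((k + 1 : ℕ) : ℝ) + (γ + 1)) * lagCoeff (γ + 1) n (k + 1) * (-t) ^ (k + 1) +
          lagCoeff (γ + 1) n k * (-t) ^ (k + 1)) := by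
    refine Finset.sum_congr rfl fun k hk => ?_
    rw [lagCoeff_succ_succ hγ (Finset.mem_range.1 hk)]
    push_cast
    ring
  rw [h3, Finset.sum_range_succ, Finset.sum_range_succ', h4, Finset.sum_add_distrib,
    lagCoeff_self hγ, lagCoeff_zero_right hγ]
  rw [Finset.sum_range_succ'] at h1
  rw [Finset.sum_range_succ] at h2
  simp only [Nat.cast_zero, zero_add] at h1
  linear_combination h1 + h2

/-- The weight `t^γ e^{-t/2} L_n^γ(t)`. -/
def lagWeight (γ : ℝ) (n : ℕ) (t : ℝ) : ℝ := t ^ γ * Real.exp (-t / 2) * lagP γ n t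

lemma lagWeight_eq_sum (γ : ℝ) (n : ℕ) {t : ℝ} (ht : 0 < t) :
    lagWeight γ n t = ∑ k ∈ Finset.range (n + 1),
      lagCoeff γ n k * (-1) ^ k * (t ^ (γ + k) * Real.exp (-(1 / 2) * t)) := by
  rw [lagWeight, lagP_eq_sum, Finset.mul_sum]
  refine Finset.sum_congr rfl fun k _ => ?_
  rw [Real.rpow_add_natCast ht.ne', neg_pow, show -t / 2 = -(1 / 2) * t by ring]
  ring

lemma continuous_lagWeight {γ : ℝ} (hγ : 0 ≤ γ) (n : ℕ) : Continuous (lagWeight γ n) :=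
  ((Real.continuous_rpow_const hγ).mul (by fun_prop)).mul (continuous_lagP γ n)

lemma integrableOn_lagWeight {γ : ℝ} (hγ : 0 ≤ γ) (n : ℕ) :
    IntegrableOn (lagWeight γ n) (Set.Ioi 0) := by
  refine IntegrableOn.congr_fun ?_ (fun t ht => (lagWeight_eq_sum γ n ht).symm) measurableSet_Ioi
  refine integrable_finsetSum _ fun k _ => Integrable.const_mul ?_ _
  have := integrableOn_rpow_mul_exp_neg_mul_rpow (p := 1) (s := γ + k) (b := 1 / 2)
    (by have : (0 : ℝ) ≤ k := k.cast_nonneg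
        linarith) one_pos (by norm_num)
  simp only [Real.rpow_one] at this
  exact this

lemma tendsto_lagWeight_atTop (γ : ℝ) (n : ℕ) : Tendsto (lagWeight γ n) atTop (𝓝 0) := by
  have h : Tendsto (fun t => ∑ k ∈ Finset.range (n + 1),
      lagCoeff γ n k * (-1) ^ k * (t ^ (γ + k) * Real.exp (-(1 / 2) * t))) atTop
      (𝓝 (∑ k ∈ Finset.range (n + 1), lagCoeff γ n k * (-1) ^ k * 0)) :=
    tendsto_finsetSum _ fun k _ =>
      (tendsto_rpow_mul_exp_neg_mul_atTop_nhds_zero _ _ (by norm_num)).const_mul _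
  simp only [mul_zero, Finset.sum_const_zero] at h
  refine h.congr' ?_
  filter_upwards [eventually_gt_atTop 0] with t ht using (lagWeight_eq_sum γ n ht).symm

lemma hasDerivAt_lagWeight {γ : ℝ} (hγ : 0 ≤ γ) (n : ℕ) {t : ℝ} (ht : 0 < t) :
    HasDerivAt (lagWeight (γ + 1) n)
      ((n + 1) * lagWeight γ (n + 1) t + 1 / 2 * lagWeight (γ + 1) n t) t := by
  have h1 : HasDerivAt (fun t : ℝ => t ^ (γ + 1)) ((γ + 1) * t ^ γ) t := by
    simpa using Real.hasDerivAt_rpow_const (p := γ + 1) (Or.inl ht.ne')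
  have h2 : HasDerivAt (fun t : ℝ => Real.exp (-t / 2)) (Real.exp (-t / 2) * (-1 / 2)) t :=
    ((hasDerivAt_neg t).div_const 2).exp
  refine ((h1.mul h2).mul (hasDerivAt_lagP (γ + 1) n t)).congr_deriv ?_
  simp only [lagWeight, Real.rpow_add_one ht.ne', Pi.mul_apply]
  linear_combination t ^ γ * Real.exp (-t / 2) * lagP_raising hγ n t

section IntegrationByParts

variable {E : Type*} [NormedAddCommGroup E] [NormedSpace ℝ E]

lemma integrableOn_lagWeight_smul {γ : ℝ} (hγ : 0 ≤ γ) (n : ℕ) {f : ℝ → E} {C : ℝ}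
    (hf : ContinuousOn f (Set.Ioi 0)) (hC : ∀ t > 0, ‖f t‖ ≤ C) :
    IntegrableOn (fun t => lagWeight γ n t • f t) (Set.Ioi 0) :=
  (integrableOn_lagWeight hγ n).smul_bdd C (hf.aestronglyMeasurable measurableSet_Ioi)
    ((ae_restrict_iff' measurableSet_Ioi).2 (Eventually.of_forall fun t ht => hC t ht))

lemma tendsto_lagWeight_smul {l : Filter ℝ} {γ : ℝ} {n : ℕ} {f : ℝ → E} {C : ℝ}
    (hC : ∀ t > 0, ‖f t‖ ≤ C) (hl : ∀ᶠ t in l, 0 < t) (h : Tendsto (lagWeight γ n) l (𝓝 0)) :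
    Tendsto (fun t => lagWeight γ n t • f t) l (𝓝 0) := by
  refine squeeze_zero_norm' (a := fun t => ‖lagWeight γ n t‖ * C) ?_ ?_
  · filter_upwards [hl] with t ht
    rw [norm_smul]
    exact mul_le_mul_of_nonneg_left (hC t ht) (norm_nonneg _)
  · simpa using h.norm.mul_const C

/-- Integration by parts lowers the degree of the Laguerre weight and raises its order. -/
lemma integral_lagWeight_succ_smul [CompleteSpace E] {γ : ℝ} (hγ : 0 ≤ γ) (n : ℕ) {f f' : ℝ → E}
    {C : ℝ} (hd : ∀ t > 0, HasDerivAt f (f' t) t) (hf' : ContinuousOn f' (Set.Ioi 0))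
    (hC : ∀ t > 0, ‖f t‖ ≤ C) (hC' : ∀ t > 0, ‖f' t‖ ≤ C) :
    ((n : ℝ) + 1) • ∫ t in Set.Ioi 0, lagWeight γ (n + 1) t • f t =
      -((∫ t in Set.Ioi 0, lagWeight (γ + 1) n t • f' t) +
        (1 / 2 : ℝ) • ∫ t in Set.Ioi 0, lagWeight (γ + 1) n t • f t) := by
  have hγ1 : 0 ≤ γ + 1 := by linarith
  have hf : ContinuousOn f (Set.Ioi 0) := fun t ht => (hd t ht).continuousAt.continuousWithinAt
  have i1 := integrableOn_lagWeight_smul hγ (n + 1) hf hC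
  have i2 := integrableOn_lagWeight_smul hγ1 n hf hC
  have i3 := integrableOn_lagWeight_smul hγ1 n hf' hC'
  have h0 : lagWeight (γ + 1) n 0 = 0 := by
    simp [lagWeight, Real.zero_rpow (show γ + 1 ≠ 0 by positivity)]
  have hcont : ContinuousWithinAt (fun t => lagWeight (γ + 1) n t • f t) (Set.Ici 0) 0 := by
    rw [← continuousWithinAt_Ioi_iff_Ici, ContinuousWithinAt, h0, zero_smul]
    refine tendsto_lagWeight_smul hC self_mem_nhdsWithin ?_
    have := (continuous_lagWeight hγ1 n).continuousWithinAt (s := Set.Ioi 0) (x := 0)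
    rwa [ContinuousWithinAt, h0] at this
  have key := integral_Ioi_of_hasDerivAt_of_tendsto
    (f' := fun t => lagWeight (γ + 1) n t • f' t + (((n : ℝ) + 1) • (lagWeight γ (n + 1) t • f t) +
      (1 / 2 : ℝ) • (lagWeight (γ + 1) n t • f t))) hcont
    (fun t ht => by
      refine ((hasDerivAt_lagWeight hγ n ht).smul (hd t ht)).congr_deriv ?_
      rw [add_smul, mul_smul, mul_smul])
    (i3.add ((i1.smul _).add (i2.smul _)))
    (tendsto_lagWeight_smul hC (eventually_gt_atTop 0) (tendsto_lagWeight_atTop _ n))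
  have j1 := i1.smul ((n : ℝ) + 1)
  have j2 := i2.smul (1 / 2 : ℝ)
  have e1 := integral_add i3 (j1.add j2)
  have e2 := integral_add j1 j2
  simp only [Pi.add_apply, Pi.smul_apply] at e1 e2
  rw [e1, e2, integral_smul, integral_smul, h0, zero_smul, sub_zero] at key
  rw [eq_neg_iff_add_eq_zero, ← key]
  abel

end IntegrationByParts

lemma exists_bound_lagP_mul_exp (γ : ℝ) (n : ℕ) :
    ∃ C, ∀ t > 0, ‖lagP γ n t * Real.exp (-t / 2)‖ ≤ C := by
  refine ⟨∑ k ∈ Finset.range (n + 1), |lagCoeff γ n k| * (2 ^ k * k !), fun t ht => ?_⟩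
  rw [lagP_eq_sum, Finset.sum_mul]
  refine norm_sum_le_of_le _ fun k _ => ?_
  have h := Real.pow_div_factorial_le_exp (t / 2) (by positivity) k
  rw [div_pow, div_div, div_le_iff₀ (by positivity)] at h
  rw [Real.norm_eq_abs, abs_mul, abs_mul, abs_pow, abs_neg, abs_of_pos ht, Real.abs_exp, mul_assoc]
  refine mul_le_mul_of_nonneg_left ?_ (abs_nonneg _)
  rw [show -t / 2 = -(t / 2) by ring, Real.exp_neg, ← div_eq_mul_inv,
    div_le_iff₀ (Real.exp_pos _)]
  linarith

lemma continuous_lagP_mul_exp (γ : ℝ) (n : ℕ) :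
    Continuous fun t => lagP γ n t * Real.exp (-t / 2) :=
  (continuous_lagP γ n).mul (by fun_prop)

lemma integrableOn_lagWeight_mul_lagP {γ : ℝ} (hγ : 0 ≤ γ) (n m : ℕ) (δ : ℝ) :
    IntegrableOn (fun t => lagWeight γ n t * (lagP δ m t * Real.exp (-t / 2))) (Set.Ioi 0) := by
  obtain ⟨C, hC⟩ := exists_bound_lagP_mul_exp δ m
  exact integrableOn_lagWeight_smul hγ n (continuous_lagP_mul_exp δ m).continuousOn hC

/-- The squared norm of the Laguerre polynomial `L_n^γ` in `L²(t^γ e^{-t} dt)`. -/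
lemma integral_lagWeight_mul_lagP (n : ℕ) : ∀ {γ : ℝ}, 0 ≤ γ →
    ∫ t in Set.Ioi 0, lagWeight γ n t * (lagP γ n t * Real.exp (-t / 2)) =
      Real.Gamma (n + γ + 1) / n ! := by
  induction n with
  | zero =>
    intro γ hγ
    rw [Nat.cast_zero, zero_add, Nat.factorial_zero, Nat.cast_one, div_one,
      Real.Gamma_eq_integral (by positivity)]
    refine integral_congr_ae (Eventually.of_forall fun t => ?_)
    simp only [lagWeight, lagP_zero hγ, mul_one, one_mul, add_sub_cancel_right]
    rw [mul_assoc, ← Real.exp_add, mul_comm]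
    ring_nf
  | succ n ih =>
    intro γ hγ
    have hγ1 : 0 ≤ γ + 1 := by linarith
    obtain ⟨C, hC⟩ := exists_bound_lagP_mul_exp γ (n + 1)
    obtain ⟨C', hC'⟩ := exists_bound_lagP_mul_exp (γ + 1) n
    have hC0 : 0 ≤ C := (norm_nonneg _).trans (hC 1 one_pos)
    have hC0' : 0 ≤ C' := (norm_nonneg _).trans (hC' 1 one_pos)
    have h := integral_lagWeight_succ_smul hγ n (C := C' + C)
      (f := fun t => lagP γ (n + 1) t * Real.exp (-t / 2))
      (f' := fun t => -(lagP (γ + 1) n t * Real.exp (-t / 2)) -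
        1 / 2 * (lagP γ (n + 1) t * Real.exp (-t / 2)))
      (fun t _ => by
        have h2 : HasDerivAt (fun t : ℝ => Real.exp (-t / 2)) (Real.exp (-t / 2) * (-1 / 2)) t :=
          ((hasDerivAt_neg t).div_const 2).exp
        refine ((hasDerivAt_lagP γ (n + 1) t).mul h2).congr_deriv ?_
        rw [lagPDeriv_succ]
        ring)
      ((continuous_lagP_mul_exp _ _).neg.sub
        (continuous_const.mul (continuous_lagP_mul_exp _ _))).continuousOn
      (fun t ht => (hC t ht).trans (by linarith))
      (fun t ht => by
        refine (norm_sub_le _ _).trans ?_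
        rw [norm_neg, norm_mul (1 / 2 : ℝ), Real.norm_of_nonneg (by norm_num : (0 : ℝ) ≤ 1 / 2)]
        linarith [hC t ht, hC' t ht])
    have i1 := integrableOn_lagWeight_mul_lagP hγ1 n n (γ + 1)
    have i2 := integrableOn_lagWeight_mul_lagP hγ1 n (n + 1) γ
    have e : ∫ t in Set.Ioi 0, lagWeight (γ + 1) n t * (-(lagP (γ + 1) n t * Real.exp (-t / 2)) -
        1 / 2 * (lagP γ (n + 1) t * Real.exp (-t / 2))) =
        -(∫ t in Set.Ioi 0, lagWeight (γ + 1) n t * (lagP (γ + 1) n t * Real.exp (-t / 2))) -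
        1 / 2 * ∫ t in Set.Ioi 0, lagWeight (γ + 1) n t *
          (lagP γ (n + 1) t * Real.exp (-t / 2)) := by
      rw [← integral_neg, ← integral_const_mul]
      refine Eq.trans ?_ (integral_sub i1.neg (i2.const_mul _))
      exact integral_congr_ae (Eventually.of_forall fun t => by ring)
    simp only [smul_eq_mul] at h
    rw [e, ih hγ1] at h
    rw [Nat.factorial_succ, show ((n + 1 : ℕ) : ℝ) + γ + 1 = n + (γ + 1) + 1 by push_cast; ring]
    push_cast
    rw [mul_comm ((n : ℝ) + 1), ← div_div, eq_div_iff (by positivity)]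
    linear_combination h

/-- A Cauchy–Schwarz type bound for the pairing with a Laguerre weight. -/
lemma norm_integral_lagWeight_smul_le {γ : ℝ} (hγ : 0 ≤ γ) (n : ℕ) {g : ℝ → ℂ}
    (hg : IntegrableOn (fun t => t ^ γ * ‖g t‖ ^ 2) (Set.Ioi 0)) :
    ‖∫ t in Set.Ioi 0, lagWeight γ n t • g t‖ ≤
      ((∫ t in Set.Ioi 0, t ^ γ * ‖g t‖ ^ 2) + 1) / 2 * √(Real.Gamma (n + γ + 1) / n !) := by
  set N := Real.Gamma (n + γ + 1) / n ! with hN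
  have hN0 : 0 < N := div_pos (gamma_natCast_add_pos hγ n) (by positivity)
  have hs : 0 < √N := Real.sqrt_pos.2 hN0
  have hsN : √N * √N = N := Real.mul_self_sqrt hN0.le
  have i1 := integrableOn_lagWeight_mul_lagP hγ n n γ
  have hi := (hg.const_mul (√N / 2)).add (i1.const_mul (1 / (2 * √N)))
  refine (norm_integral_le_of_norm_le hi
    ((ae_restrict_iff' measurableSet_Ioi).2 (Eventually.of_forall fun t ht => ?_))).trans_eq ?_
  · have ht0 : 0 ≤ t ^ γ := Real.rpow_nonneg (le_of_lt ht) γ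
    set L := lagP γ n t * Real.exp (-t / 2) with hL
    have hw : lagWeight γ n t = t ^ γ * L := by rw [lagWeight, hL]; ring
    simp only [Pi.add_apply]
    rw [hw, norm_smul, norm_mul, Real.norm_of_nonneg ht0, Real.norm_eq_abs]
    have hsq : |L| * |L| = L * L := abs_mul_abs_self L
    have e : √N / 2 * (t ^ γ * ‖g t‖ ^ 2) + 1 / (2 * √N) * (t ^ γ * L * L) -
        t ^ γ * |L| * ‖g t‖ = t ^ γ * (√N * ‖g t‖ - |L|) ^ 2 / (2 * √N) := by
      rw [mul_assoc (t ^ γ) L L, ← hsq]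
      field_simp
      ring
    have : 0 ≤ t ^ γ * (√N * ‖g t‖ - |L|) ^ 2 / (2 * √N) := by positivity
    linarith
  · have e1 := integral_add (hg.const_mul (√N / 2)) (i1.const_mul (1 / (2 * √N)))
    simp only [Pi.add_apply]
    rw [e1, integral_const_mul, integral_const_mul, integral_lagWeight_mul_lagP n hγ, ← hN]
    field_simp
    linear_combination -hsN

lemma IsSPlus1.deriv {f : ℝ → ℂ} (hf : IsSPlus1 f) : IsSPlus1 (deriv f) :=
  ⟨hf.1.deriv_of_isOpen isOpen_Ioi (by simp), fun p => hf.2.1 (p + 1), fun k p => hf.2.2 k (p + 1)⟩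

lemma IsSPlus1.integrableOn_sq {f : ℝ → ℂ} (hf : IsSPlus1 f) {γ : ℝ} (hγ : 0 ≤ γ) :
    IntegrableOn (fun t => t ^ γ * ‖f t‖ ^ 2) (Set.Ioi 0) := by
  obtain ⟨N, hN⟩ := exists_nat_ge γ
  obtain ⟨C0, h0⟩ := hf.2.2 0 0
  obtain ⟨C2, h2⟩ := hf.2.2 2 0
  obtain ⟨C3, h3⟩ := hf.2.2 N 0
  obtain ⟨C4, h4⟩ := hf.2.2 (N + 2) 0
  simp only [Function.iterate_zero, id_eq, pow_zero, one_mul] at h0 h2 h3 h4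
  have hfc : ContinuousOn f (Set.Ioi 0) := hf.1.continuousOn
  refine Integrable.mono'
    (integrable_inv_one_add_sq.integrableOn.const_mul (C0 * (C0 + C2 + C3 + C4)))
    (((Real.continuous_rpow_const hγ).continuousOn.mul
      (hfc.norm.pow 2)).aestronglyMeasurable measurableSet_Ioi)
    ((ae_restrict_iff' measurableSet_Ioi).2 (Eventually.of_forall fun t (ht : 0 < t) => ?_))
  have htγ : t ^ γ ≤ 1 + t ^ N := by
    rcases le_total t 1 with h | h
    · linarith [Real.rpow_le_one ht.le h hγ, pow_pos ht N]
    · have := Real.rpow_le_rpow_of_exponent_le h hN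
      rw [Real.rpow_natCast] at this
      linarith
  have hC0 : 0 ≤ C0 := (norm_nonneg _).trans (h0 t ht)
  rw [Real.norm_of_nonneg (by positivity), ← div_eq_mul_inv, le_div_iff₀ (by positivity)]
  calc t ^ γ * ‖f t‖ ^ 2 * (1 + t ^ 2)
      ≤ (1 + t ^ N) * ‖f t‖ ^ 2 * (1 + t ^ 2) := by gcongr
    _ = ‖f t‖ * (‖f t‖ + t ^ 2 * ‖f t‖ + t ^ N * ‖f t‖ + t ^ (N + 2) * ‖f t‖) := by ring
    _ ≤ C0 * (C0 + C2 + C3 + C4) := by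
      have := h0 t ht
      have := h2 t ht
      have := h3 t ht
      have := h4 t ht
      gcongr

/-- Integrating by parts `k` times gains the factor `√(n! / (n+k)!)` in the pairing of a function
in `S(ℝ₊)` with the normalised Laguerre weight of degree `n + k`. -/
lemma IsSPlus1.exists_norm_integral_le (k : ℕ) : ∀ {γ : ℝ}, 0 ≤ γ → ∀ {f : ℝ → ℂ}, IsSPlus1 f →
    ∃ C ≥ 0, ∀ n : ℕ, ‖∫ t in Set.Ioi 0, lagWeight γ (n + k) t • f t‖ ≤
      C * (n ! / (n + k) !) * √(Real.Gamma (n + k + γ + 1) / n !) := by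
  induction k with
  | zero =>
    intro γ hγ f hf
    refine ⟨((∫ t in Set.Ioi 0, t ^ γ * ‖f t‖ ^ 2) + 1) / 2, ?_, fun n => ?_⟩
    · have : 0 ≤ ∫ t in Set.Ioi 0, t ^ γ * ‖f t‖ ^ 2 :=
        setIntegral_nonneg measurableSet_Ioi fun t (ht : 0 < t) => by positivity
      positivity
    · have h := norm_integral_lagWeight_smul_le hγ n (hf.integrableOn_sq hγ)
      rw [Nat.add_zero, div_self (by positivity), mul_one, Nat.cast_zero, add_zero]
      exact h
  | succ k ih =>
    intro γ hγ f hf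
    have hγ1 : 0 ≤ γ + 1 := by linarith
    obtain ⟨C1, hC1, h1⟩ := ih hγ1 hf
    obtain ⟨C2, hC2, h2⟩ := ih hγ1 hf.deriv
    obtain ⟨B0, hB0⟩ := hf.2.2 0 0
    obtain ⟨B1, hB1⟩ := hf.2.2 0 1
    simp only [Function.iterate_zero, id_eq, pow_zero, one_mul, Function.iterate_one] at hB0 hB1
    refine ⟨C2 + C1, by positivity, fun n => ?_⟩
    have h := congrArg norm (integral_lagWeight_succ_smul hγ (n + k) (C := max B0 B1)
      (fun t ht => ((hf.1.differentiableOn (by simp)).differentiableAt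
        (Ioi_mem_nhds ht)).hasDerivAt) hf.deriv.1.continuousOn
      (fun t ht => (hB0 t ht).trans (le_max_left _ _))
      (fun t ht => (hB1 t ht).trans (le_max_right _ _)))
    rw [norm_smul, norm_neg, Real.norm_of_nonneg (by positivity)] at h
    have hle := h.le.trans (norm_add_le _ _)
    rw [norm_smul, Real.norm_of_nonneg (by norm_num : (0 : ℝ) ≤ 1 / 2)] at hle
    have h1n := h1 n
    have h2n := h2 n
    have hpos := norm_nonneg (∫ t in Set.Ioi 0, lagWeight (γ + 1) (n + k) t • f t)
    rw [← Nat.add_assoc, Nat.factorial_succ,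
      show (n : ℝ) + (k + 1 : ℕ) + γ + 1 = n + k + (γ + 1) + 1 by push_cast; ring]
    have hd : (0 : ℝ) < ((n + k : ℕ) : ℝ) + 1 := by positivity
    refine le_of_mul_le_mul_left ?_ hd
    refine (hle.trans (show _ ≤ (C2 + C1) * ((n ! : ℝ) / (n + k) !) *
      √(Real.Gamma (n + k + (γ + 1) + 1) / n !) by linarith)).trans_eq ?_
    push_cast
    field_simp

lemma integral_mul_lagFun (γ : ℝ) (f : ℝ → ℂ) (n : ℕ) :
    ∫ t in Set.Ioi (0 : ℝ), f t * (lagFun γ n t : ℂ) * ((t ^ γ : ℝ) : ℂ) =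
      √(n ! / Real.Gamma (n + γ + 1)) • ∫ t in Set.Ioi (0 : ℝ), lagWeight γ n t • f t := by
  rw [← integral_smul]
  refine integral_congr_ae (Eventually.of_forall fun t => ?_)
  simp only [lagFun, lagWeight, Complex.real_smul]
  push_cast
  ring

lemma sqrt_factorial_div_le (n j : ℕ) :
    √((n ! : ℝ) / (n + 2 * j) !) ≤ (2 * j + 1) ^ j * (((n + 2 * j : ℕ) : ℝ) + 1) ^ (-(j : ℝ)) := by
  rw [Real.rpow_neg (by positivity), Real.rpow_natCast, ← div_eq_mul_inv, ← div_pow]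
  refine Real.sqrt_le_iff.2 ⟨by positivity, ?_⟩
  have h : (n ! : ℝ) * (n + 1) ^ (2 * j) ≤ (n + 2 * j) ! := by
    exact_mod_cast Nat.factorial_mul_pow_le_factorial (m := n) (n := 2 * j)
  have h1 : (n ! : ℝ) / (n + 2 * j) ! ≤ (1 / (n + 1)) ^ (2 * j) := by
    rw [div_pow, one_pow, div_le_div_iff₀ (by positivity) (by positivity)]
    linarith
  refine h1.trans ?_
  rw [← pow_mul, mul_comm j 2]
  gcongr ?_ ^ _
  rw [div_le_div_iff₀ (by positivity) (by positivity)]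
  push_cast
  nlinarith [mul_nonneg (n.cast_nonneg (α := ℝ)) (j.cast_nonneg (α := ℝ))]

/-- For `γ ≥ 0` and `f ∈ S(ℝ₊)`, the Fourier-Laguerre coefficients
`a_n = ∫₀^∞ f(t) 𝓛_n^γ(t) t^γ dt` are rapidly decreasing. -/
theorem stmt2 (γ : ℝ) (hγ : 0 ≤ γ) (f : ℝ → ℂ) (hf : IsSPlus1 f) (a : ℕ → ℂ)
    (ha : ∀ n : ℕ, a n = ∫ t in Set.Ioi (0:ℝ), f t * (lagFun γ n t : ℂ) * ((t ^ γ : ℝ) : ℂ)) :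
    ∀ j : ℕ, ∃ C > (0:ℝ), ∀ n : ℕ, ‖a n‖ ≤ C * ((n : ℝ) + 1) ^ (-(j : ℝ)) := by
  intro j
  obtain ⟨C, hC, h⟩ := hf.exists_norm_integral_le (2 * j) hγ
  have hsum : ∀ n : ℕ, 0 ≤ ‖a n‖ * ((n : ℝ) + 1) ^ j := fun n => by positivity
  set S := ∑ n ∈ Finset.range (2 * j), ‖a n‖ * ((n : ℝ) + 1) ^ j with hS
  have hS0 : 0 ≤ S := Finset.sum_nonneg fun n _ => hsum n
  refine ⟨C * (2 * j + 1) ^ j + S + 1, by positivity, fun m => ?_⟩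
  have hm : (0 : ℝ) < ((m : ℝ) + 1) ^ (-(j : ℝ)) := by positivity
  rcases lt_or_ge m (2 * j) with hmj | hmj
  · have h1 : ‖a m‖ * ((m : ℝ) + 1) ^ j ≤ S :=
      Finset.single_le_sum (f := fun n : ℕ => ‖a n‖ * ((n : ℝ) + 1) ^ j) (fun n _ => hsum n)
        (Finset.mem_range.2 hmj)
    have h2 : ‖a m‖ ≤ S * ((m : ℝ) + 1) ^ (-(j : ℝ)) := by
      rw [Real.rpow_neg (by positivity), Real.rpow_natCast, ← div_eq_mul_inv,
        le_div_iff₀ (by positivity)]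
      exact h1
    refine h2.trans ?_
    gcongr
    have : 0 ≤ C * (2 * (j : ℝ) + 1) ^ j := by positivity
    linarith
  · obtain ⟨n, rfl⟩ := Nat.exists_eq_add_of_le' hmj
    have hG := gamma_natCast_add_pos hγ (n + 2 * j)
    have hcast : (n : ℝ) + (2 * j : ℕ) = (n + 2 * j : ℕ) := by push_cast; ring
    have hn := h n
    rw [hcast] at hn
    have key : ‖a (n + 2 * j)‖ ≤ C * √((n ! : ℝ) / (n + 2 * j) !) := by
      rw [ha, integral_mul_lagFun, norm_smul, Real.norm_of_nonneg (Real.sqrt_nonneg _)]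
      refine (mul_le_mul_of_nonneg_left hn (Real.sqrt_nonneg _)).trans_eq ?_
      set G := Real.Gamma ((n + 2 * j : ℕ) + γ + 1)
      have e : √(((n + 2 * j) ! : ℝ) / G) * √(G / n !) = (√((n ! : ℝ) / (n + 2 * j) !))⁻¹ := by
        rw [← Real.sqrt_mul (by positivity), ← Real.sqrt_inv]
        congr 1
        field_simp
      have hx : (0 : ℝ) < n ! / (n + 2 * j) ! := by positivity
      have hs := Real.mul_self_sqrt hx.le
      calc _ = C * ((n ! : ℝ) / (n + 2 * j) !) *
            (√(((n + 2 * j) ! : ℝ) / G) * √(G / n !)) := by ring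
        _ = _ := by
          rw [e]
          nth_rewrite 1 [← hs]
          have := (Real.sqrt_pos.2 hx).ne'
          rw [mul_assoc, mul_inv_cancel_right₀ this]
    refine key.trans ((mul_le_mul_of_nonneg_left (sqrt_factorial_div_le n j) hC).trans ?_)
    rw [← mul_assoc]
    gcongr
    linarith
end
end

section
/- Let z ∈ 𝕋^{(d)}, and write z_l = e^{iθ_l} with θ_l ∈ (−π,π]∖{0} for l = 1,…,d. Then for every n ∈ ℕ₀^d and every t ∈ ℝ^d₊, J_{z,0} 𝓛_n(t) = 2^d (−1)^{|n|} (∏_{l=1}^d (1−z_l)^{−1}) · 𝓛_n(t₁/sin²(θ₁/2), …, t_d/sin²(θ_d/2)). -/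
open MeasureTheory Filter Finset

noncomputable section

def Rpos (d : ℕ) : Set (Fin d → ℝ) := {x | ∀ i, 0 < x i}

/-- Laguerre polynomial of order `0`. -/
def lag0 (j : ℕ) (t : ℝ) : ℝ :=
  ∑ k ∈ Finset.range (j+1),
    (j.factorial : ℝ) / ((j-k).factorial * ((k.factorial : ℝ))^2) * (-t)^k

/-- Laguerre function of order `0`: `𝓛_j(t) = L_j(t) e^{−t/2}`. -/
def lagFun0 (j : ℕ) (t : ℝ) : ℝ := lag0 j t * Real.exp (-t/2)

/-- `d`-dimensional Laguerre function of order `0`. -/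
def LagFun0 {d : ℕ} (n : Fin d → ℕ) (t : Fin d → ℝ) : ℝ := ∏ l, lagFun0 (n l) (t l)

/-- The entire function `K₀(u) = ∑ u^k/(k!)²`. -/
def K0 (u : ℂ) : ℂ := ∑' k : ℕ, u ^ k / ((k.factorial : ℂ))^2

/-- Modified fractional power of the Hankel-Clifford transform of order `0`. -/
def J0 {d : ℕ} (z : Fin d → ℂ) (f : (Fin d → ℝ) → ℂ) : (Fin d → ℝ) → ℂ :=
  fun t => (∏ l, (1 - z l)⁻¹) *
    ∫ x in Rpos d, f x * ∏ l, K0 ((x l : ℂ) * (t l : ℂ) * z l / (1 - z l)^2)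

theorem add_choose_eq_sum_choose_mul_choose {n j : ℕ} (hj : j ≤ n) (k : ℕ) :
    (j + k).choose k = ∑ i ∈ range (n + 1), k.choose i * j.choose i := by
  rw [show (j + k).choose k = (k + j).choose j by
    rw [add_comm j k]; exact Nat.choose_symm_add, Nat.add_choose_eq,
    Nat.sum_antidiagonal_eq_sum_range_succ_mk]
  refine (sum_congr rfl fun i hi => ?_).trans
    (sum_subset (range_subset_range.2 (by omega)) fun i _ hi => ?_)
  · rw [Nat.choose_symm (by simpa [Nat.lt_succ_iff] using hi)]
  · rw [Nat.choose_eq_zero_of_lt (n := j) (by simpa [Nat.lt_succ_iff] using hi), mul_zero]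

theorem sum_choose_mul_choose_mul_neg_two_pow (n i : ℕ) (hi : i ≤ n) :
    ∑ j ∈ range (n + 1), (n.choose j : ℂ) * j.choose i * (-2) ^ j
      = (-1) ^ n * (n.choose i * 2 ^ i) := by
  obtain ⟨p, rfl⟩ := Nat.exists_eq_add_of_le hi
  rw [add_assoc, sum_range_add, sum_eq_zero (s := range i), zero_add]
  · have h (m : ℕ) : ((i + p).choose (i + m) : ℂ) * (i + m).choose i
        = (i + p).choose i * p.choose m := by
      have := Nat.choose_mul (n := i + p) (k := i + m) (s := i) (by omega)
      simp only [Nat.add_sub_cancel_left] at this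
      exact_mod_cast this
    have hb := add_pow (-2 : ℂ) 1 p
    simp only [one_pow, mul_one] at hb
    simp_rw [h, pow_add]
    calc _ = ((i + p).choose i : ℂ) * (-2) ^ i * ∑ m ∈ range (p + 1), (-2 : ℂ) ^ m * p.choose m := by
          rw [mul_sum]; exact sum_congr rfl fun m _ => by ring
      _ = _ := by
          rw [← hb, show (-2 : ℂ) ^ i = (-1) ^ i * 2 ^ i by rw [← mul_pow]; norm_num]
          norm_num
          ring
  · intro j hj
    rw [Nat.choose_eq_zero_of_lt (mem_range.1 hj)]
    simp

theorem sum_choose_mul_add_choose_mul_neg_two_pow (n k : ℕ) :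
    ∑ j ∈ range (n + 1), (n.choose j : ℂ) * (j + k).choose k * (-2) ^ j
      = (-1) ^ n * ∑ i ∈ range (n + 1), (n.choose i : ℂ) * 2 ^ i * k.choose i := by
  calc _ = ∑ j ∈ range (n + 1), ∑ i ∈ range (n + 1),
        (k.choose i : ℂ) * (n.choose j * j.choose i * (-2) ^ j) := by
        refine sum_congr rfl fun j hj => ?_
        rw [add_choose_eq_sum_choose_mul_choose (n := n) (by simpa [Nat.lt_succ_iff] using hj)]
        push_cast
        rw [mul_sum, sum_mul]
        exact sum_congr rfl fun i _ => by ring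
    _ = _ := by
        rw [sum_comm, mul_sum]
        refine sum_congr rfl fun i hi => ?_
        rw [← mul_sum, sum_choose_mul_choose_mul_neg_two_pow n i
          (by simpa [Nat.lt_succ_iff] using hi)]
        ring

theorem hasSum_choose_mul_pow_div_factorial (i : ℕ) (w : ℂ) :
    HasSum (fun k : ℕ => (k.choose i : ℂ) * (w ^ k / k.factorial))
      (w ^ i / i.factorial * Complex.exp w) := by
  rw [← hasSum_nat_add_iff' i, sum_eq_zero, sub_zero, Complex.exp_eq_exp_ℂ]
  · refine ((NormedSpace.expSeries_div_hasSum_exp w).mul_left _).congr_fun fun k => ?_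
    have hc : ((k + i).choose i : ℂ) * k.factorial * i.factorial = (k + i).factorial := by
      exact_mod_cast Nat.add_choose_mul_factorial_mul_factorial k i
    have h1 : (k.factorial : ℂ) ≠ 0 := by exact_mod_cast k.factorial_ne_zero
    have h2 : (i.factorial : ℂ) ≠ 0 := by exact_mod_cast i.factorial_ne_zero
    have h3 : ((k + i).choose i : ℂ) ≠ 0 := by
      exact_mod_cast (Nat.choose_pos (Nat.le_add_left i k)).ne'
    rw [← hc]
    field_simp
    ring
  · intro j hj
    rw [Nat.choose_eq_zero_of_lt (mem_range.1 hj)]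
    simp

theorem integrableOn_pow_mul_exp_neg_half (m : ℕ) :
    IntegrableOn (fun x : ℝ => x ^ m * Real.exp (-x / 2)) (Set.Ioi 0) := by
  have h := integrableOn_rpow_mul_exp_neg_mul_rpow (p := 1) (s := m) (b := 1 / 2)
    (by have := m.cast_nonneg (α := ℝ); linarith) one_pos (by norm_num)
  refine h.congr_fun (fun x _ => ?_) measurableSet_Ioi
  simp only [Real.rpow_natCast, Real.rpow_one]
  ring_nf

theorem integral_pow_mul_exp_neg_half (m : ℕ) :
    ∫ x in Set.Ioi (0 : ℝ), x ^ m * Real.exp (-x / 2) = m.factorial * 2 ^ (m + 1) := by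
  have h := Real.integral_rpow_mul_exp_neg_mul_Ioi (a := m + 1) (r := 1 / 2)
    (by positivity) (by norm_num)
  rw [Real.Gamma_nat_eq_factorial, one_div_one_div, ← Nat.cast_succ, Real.rpow_natCast,
    mul_comm] at h
  rw [← h]
  refine setIntegral_congr_fun measurableSet_Ioi fun x _ => ?_
  simp only [Nat.cast_succ, add_sub_cancel_right, Real.rpow_natCast]
  ring_nf

theorem summable_add_factorial_mul_pow (j : ℕ) (r : ℝ) (hr : 0 ≤ r) :
    Summable fun k : ℕ => ((j + k).factorial : ℝ) * 2 ^ (j + k + 1) * (r ^ k / k.factorial ^ 2) := by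
  refine Summable.of_nonneg_of_le (fun k => by positivity) (fun k => ?_)
    ((Real.summable_pow_div_factorial (4 * r)).mul_left ((j.factorial : ℝ) * 2 * 4 ^ j))
  have hc : (((j + k).choose k : ℕ) : ℝ) * j.factorial * k.factorial = (j + k).factorial := by
    exact_mod_cast Nat.add_choose_mul_factorial_mul_factorial j k
  have hle : (((j + k).choose k : ℕ) : ℝ) ≤ 2 ^ (j + k) := by
    exact_mod_cast Nat.choose_le_two_pow (j + k) k
  rw [← hc]
  calc _ = (((j + k).choose k : ℕ) : ℝ)
        * (j.factorial * 2 ^ (j + k + 1) * (r ^ k / k.factorial)) := by field_simp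
    _ ≤ 2 ^ (j + k) * (j.factorial * 2 ^ (j + k + 1) * (r ^ k / k.factorial)) := by gcongr
    _ = _ := by
        rw [mul_pow, show (4 : ℝ) = 2 * 2 by norm_num, mul_pow, mul_pow]
        ring

theorem hasSum_integral_polynomial_mul_exp_mul_K0 (N : ℕ) (c : ℕ → ℝ) (b : ℂ) :
    HasSum (fun k : ℕ => ∑ j ∈ range N,
        (c j : ℂ) * ((j + k).factorial * 2 ^ (j + k + 1)) * (b ^ k / k.factorial ^ 2))
      (∫ x in Set.Ioi (0 : ℝ),
        (((∑ j ∈ range N, c j * x ^ j) * Real.exp (-x / 2) : ℝ) : ℂ) * K0 (x * b)) := by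
  have hterm (k : ℕ) (x : ℝ) :
      (((∑ j ∈ range N, c j * x ^ j) * Real.exp (-x / 2) : ℝ) : ℂ)
          * ((x * b) ^ k / k.factorial ^ 2)
        = ∑ j ∈ range N, ((x ^ (j + k) * Real.exp (-x / 2) : ℝ) : ℂ)
          * (c j * (b ^ k / k.factorial ^ 2)) := by
    push_cast
    rw [sum_mul, sum_mul]
    refine sum_congr rfl fun j _ => ?_
    ring
  have hint (k j : ℕ) : IntegrableOn (fun x : ℝ => ((x ^ (j + k) * Real.exp (-x / 2) : ℝ) : ℂ)
      * (c j * (b ^ k / k.factorial ^ 2))) (Set.Ioi 0) :=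
    (integrableOn_pow_mul_exp_neg_half (j + k)).ofReal.mul_const _
  have key := hasSum_integral_of_summable_integral_norm (μ := volume.restrict (Set.Ioi (0 : ℝ)))
    (F := fun (k : ℕ) (x : ℝ) => (((∑ j ∈ range N, c j * x ^ j) * Real.exp (-x / 2) : ℝ) : ℂ)
          * ((x * b) ^ k / k.factorial ^ 2))
    (fun k => by
      simp_rw [hterm]
      exact integrable_finsetSum _ fun j _ => hint k j) ?_
  · simp_rw [tsum_mul_left] at key
    refine key.congr_fun fun k => ?_
    simp_rw [hterm]
    rw [integral_finsetSum _ fun j _ => hint k j]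
    refine sum_congr rfl fun j _ => ?_
    rw [integral_mul_const, integral_complex_ofReal, integral_pow_mul_exp_neg_half]
    push_cast
    ring
  · refine Summable.of_nonneg_of_le (fun k => integral_nonneg fun x => norm_nonneg _) (fun k => ?_)
      (summable_sum (s := range N) fun j _ =>
        (summable_add_factorial_mul_pow j ‖b‖ (norm_nonneg b)).mul_left |c j|)
    calc _ ≤ ∫ x in Set.Ioi (0 : ℝ), ∑ j ∈ range N, ‖((x ^ (j + k) * Real.exp (-x / 2) : ℝ) : ℂ)
          * (c j * (b ^ k / k.factorial ^ 2))‖ := by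
          refine integral_mono_of_nonneg (ae_of_all _ fun x => norm_nonneg _)
            (integrable_finsetSum _ fun j _ => (hint k j).norm) (ae_of_all _ fun x => ?_)
          simp only [hterm]
          exact norm_sum_le _ _
      _ = _ := by
          rw [integral_finsetSum _ fun j _ => (hint k j).norm]
          refine sum_congr rfl fun j _ => ?_
          rw [← integral_pow_mul_exp_neg_half, ← integral_mul_const, ← integral_const_mul]
          refine setIntegral_congr_fun measurableSet_Ioi fun x hx => ?_
          have hx0 : (0 : ℝ) < x := hx
          have hpos : 0 ≤ x ^ (j + k) * Real.exp (-x / 2) := by positivity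
          simp only [norm_mul, norm_div, norm_pow, Complex.norm_real, Complex.norm_natCast,
            Real.norm_eq_abs]
          rw [← abs_pow, ← abs_mul, abs_of_nonneg hpos]
          ring

theorem lagFun0_eq (n : ℕ) (x : ℝ) :
    lagFun0 n x = (∑ j ∈ range (n + 1), (n.choose j * (-1) ^ j / j.factorial : ℝ) * x ^ j)
      * Real.exp (-x / 2) := by
  rw [lagFun0, lag0]
  congr 1
  refine sum_congr rfl fun j hj => ?_
  rw [Nat.cast_choose ℝ (by simpa [Nat.lt_succ_iff] using hj), neg_pow]
  field_simp

theorem integral_lagFun0_mul_K0 (n : ℕ) (τ : ℝ) :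
    ∫ x in Set.Ioi (0 : ℝ), (lagFun0 n x : ℂ) * K0 (x * (-τ / 4))
      = 2 * (-1) ^ n * (lagFun0 n τ : ℂ) := by
  have h := hasSum_integral_polynomial_mul_exp_mul_K0 (n + 1)
    (fun j => n.choose j * (-1) ^ j / j.factorial) (-τ / 4)
  simp_rw [← lagFun0_eq] at h
  have h2 := (hasSum_sum (s := range (n + 1)) fun i _ =>
    (hasSum_choose_mul_pow_div_factorial i (-τ / 2 : ℂ)).mul_left
      ((n.choose i : ℂ) * 2 ^ i)).mul_left (2 * (-1 : ℂ) ^ n)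
  refine (h.unique (h2.congr_fun fun k => ?_)).trans ?_
  · have hk : (k.factorial : ℂ) ≠ 0 := by exact_mod_cast k.factorial_ne_zero
    have := sum_choose_mul_add_choose_mul_neg_two_pow n k
    calc _ = 2 * ((-τ / 2 : ℂ) ^ k / k.factorial)
          * ∑ j ∈ range (n + 1), (n.choose j : ℂ) * (j + k).choose k * (-2) ^ j := by
          rw [mul_sum]
          refine sum_congr rfl fun j _ => ?_
          have hj : (j.factorial : ℂ) ≠ 0 := by exact_mod_cast j.factorial_ne_zero
          have hc : ((j + k).choose k : ℂ) * j.factorial * k.factorial = (j + k).factorial := by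
            exact_mod_cast Nat.add_choose_mul_factorial_mul_factorial j k
          rw [← hc, show (-τ / 2 : ℂ) = 2 * (-τ / 4) by ring, mul_pow,
            show (-2 : ℂ) ^ j = (-1) ^ j * 2 ^ j by rw [← mul_pow]; norm_num]
          push_cast
          field_simp
          ring
      _ = _ := by
          rw [this]
          simp_rw [mul_sum]
          exact sum_congr rfl fun i _ => by ring
  · rw [lagFun0_eq]
    push_cast
    rw [sum_mul]
    congr 1
    refine sum_congr rfl fun i _ => ?_
    rw [show (-τ / 2 : ℂ) ^ i = (-1) ^ i * τ ^ i / 2 ^ i by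
      rw [div_pow, neg_pow]]
    field_simp

theorem exp_mul_I_div_one_sub_sq (θ : ℝ) (h : Real.sin (θ / 2) ≠ 0) :
    Complex.exp (θ * Complex.I) / (1 - Complex.exp (θ * Complex.I)) ^ 2
      = -1 / (4 * (Real.sin (θ / 2) : ℂ) ^ 2) := by
  have hs : (Real.sin (θ / 2) : ℂ) ≠ 0 := by exact_mod_cast h
  set u := Complex.exp ((θ / 2 : ℝ) * Complex.I) with hu
  have hu0 : u ≠ 0 := Complex.exp_ne_zero _
  have hz : Complex.exp (θ * Complex.I) = u ^ 2 := by
    rw [hu, ← Complex.exp_nat_mul]; push_cast; ring_nf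
  have hsin : (Real.sin (θ / 2) : ℂ) = (u⁻¹ - u) * Complex.I / 2 := by
    rw [Complex.ofReal_sin, Complex.sin, hu, ← Complex.exp_neg, neg_mul]
  have hsq : (1 - u ^ 2) ^ 2 = -4 * (Real.sin (θ / 2) : ℂ) ^ 2 * u ^ 2 := by
    rw [hsin, div_pow, mul_pow, Complex.I_sq]
    field_simp
    ring
  rw [hz, hsq]
  field_simp

theorem integral_Rpos_prod {d : ℕ} (f : Fin d → ℝ → ℂ) :
    ∫ x in Rpos d, ∏ l, f l (x l) = ∏ l, ∫ x in Set.Ioi (0 : ℝ), f l x := by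
  have hR : Rpos d = Set.univ.pi fun _ => Set.Ioi 0 := by
    ext x
    simp [Rpos]
  rw [hR, volume_pi, Measure.restrict_pi_pi, integral_fintype_prod_eq_prod]

/-- For `z_l = e^{iθ_l}`, `θ_l ∈ (−π,π]∖{0}`:
`J_{z,0} 𝓛_n(t) = 2^d (−1)^{|n|} ∏(1−z_l)^{−1} 𝓛_n(t₁/sin²(θ₁/2),…,t_d/sin²(θ_d/2))`. -/
theorem stmt4 {d : ℕ} (z : Fin d → ℂ) (θ : Fin d → ℝ)
    (hθ : ∀ l, θ l ∈ Set.Ioc (-Real.pi) Real.pi ∧ θ l ≠ 0)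
    (hz : ∀ l, z l = Complex.exp ((θ l : ℂ) * Complex.I))
    (n : Fin d → ℕ) (t : Fin d → ℝ) (ht : t ∈ Rpos d) :
    J0 z (fun x => (LagFun0 n x : ℂ)) t =
      (2 : ℂ) ^ d * (-1 : ℂ) ^ (∑ i, n i) * (∏ l, (1 - z l)⁻¹) *
        ((LagFun0 n (fun l => t l / (Real.sin (θ l / 2))^2) : ℝ) : ℂ) := by
  have hsin (l : Fin d) : Real.sin (θ l / 2) ≠ 0 := by
    obtain ⟨⟨h1, h2⟩, h3⟩ := hθ l
    rw [Ne, Real.sin_eq_zero_iff_of_lt_of_lt (by linarith [Real.pi_pos])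
      (by linarith [Real.pi_pos])]
    exact div_ne_zero h3 two_ne_zero
  have harg (l : Fin d) (x : ℝ) : (x : ℂ) * t l * z l / (1 - z l) ^ 2
      = x * (-((t l / Real.sin (θ l / 2) ^ 2 : ℝ) : ℂ) / 4) := by
    rw [mul_div_assoc, hz l, exp_mul_I_div_one_sub_sq _ (hsin l)]
    push_cast
    field_simp
  simp only [J0, LagFun0, Complex.ofReal_prod, harg, ← prod_mul_distrib]
  rw [integral_Rpos_prod fun l x => (lagFun0 (n l) x : ℂ)
    * K0 (x * (-((t l / Real.sin (θ l / 2) ^ 2 : ℝ) : ℂ) / 4))]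
  simp_rw [integral_lagFun0_mul_K0]
  rw [prod_mul_distrib, prod_mul_distrib, prod_pow_eq_pow_sum]
  simp only [prod_const, card_univ, Fintype.card_fin]
  ring
end
end
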